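/- Thompson's group V does not have Kazhdan's property (T): for every finite subset S ⊆ V and every ε > 0, there exist a complex Hilbert space H, a group homomorphism π from V to the group of unitary operators on H, and a unit vector ξ ∈ H such that ‖π(s)ξ − ξ‖ < ε for all s ∈ S, while the only vector of H fixed by π(g) for all g ∈ V is the zero vector. -/

import Mathlib

/-- A dyadic rational: a number of the form `a / 2 ^ b` with `a, b` integers. -/
def IsDyadic (x : ℝ) : Prop := ∃ (a : ℤ) (b : ℕ), x = (a : ℝ) / 2 ^ b

/-- `[a,b]` is a standard dyadic interval `[k/2^m, (k+1)/2^m] ⊆ [0,1]`. -/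
def IsStdDyadicInterval (a b : ℝ) : Prop :=
  ∃ (k m : ℕ), a = (k : ℝ) / 2 ^ m ∧ b = ((k : ℝ) + 1) / 2 ^ m ∧ b ≤ 1

/-- A standard dyadic partition `0 = x₀ < x₁ < ⋯ < xₙ = 1` of `[0,1]`. -/
def IsStdDyadicPartition {n : ℕ} (x : Fin (n + 1) → ℝ) : Prop :=
  x 0 = 0 ∧ x (Fin.last n) = 1 ∧ StrictMono x ∧
  ∀ i : Fin n, IsStdDyadicInterval (x i.castSucc) (x i.succ)

/-- Extend a self-map of `[0,1)` to a map `ℝ → ℝ` (by the identity outside `[0,1)`). -/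
noncomputable def extIco (g : Set.Ico (0:ℝ) 1 → Set.Ico (0:ℝ) 1) : ℝ → ℝ :=
  fun x => if hx : x ∈ Set.Ico (0:ℝ) 1 then (g ⟨x, hx⟩ : ℝ) else x

/-- Membership in Thompson's group `V`: a bijection of `[0,1)` for which there are two
standard dyadic partitions with the same number `n` of intervals and a permutation `σ`
of `{1,…,n}` such that `g` maps the `i`-th half-open interval of the first partition
affinely and increasingly onto the `σ(i)`-th half-open interval of the second. -/
def IsThompsonV (g : Equiv.Perm (Set.Ico (0:ℝ) 1)) : Prop :=
  ∃ (n : ℕ) (x y : Fin (n + 1) → ℝ) (σ : Equiv.Perm (Fin n)),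
    IsStdDyadicPartition x ∧ IsStdDyadicPartition y ∧
    ∀ i : Fin n, ∀ t ∈ Set.Ico (x i.castSucc) (x i.succ),
      extIco ⇑g t =
        y (σ i).castSucc +
          ((y (σ i).succ - y (σ i).castSucc) / (x i.succ - x i.castSucc)) *
            (t - x i.castSucc)

open scoped Pointwise symmDiff

section Kernel

variable {E : Type} [NormedAddCommGroup E] [InnerProductSpace ℂ E]

/-- A total family indexed by a group whose Gram matrix is invariant under left translation
carries a unitary representation extending left translation. -/
theorem exists_unitaryRep_of_total [CompleteSpace E] {G : Type} [Group G] (k : G → E)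
    (hk : (Submodule.span ℂ (Set.range k)).topologicalClosure = ⊤)
    (hinv : ∀ a g h, inner ℂ (k (a * g)) (k (a * h)) = inner ℂ (k g) (k h)) :
    ∃ π : G →* (E ≃ₗᵢ[ℂ] E), ∀ a g, π a (k g) = k (a * g) := by
  classical
  let e : (G →₀ ℂ) →ₗ[ℂ] E := Finsupp.linearCombination ℂ k
  have hd : DenseRange e := by
    have h : (Set.range e) = (Submodule.span ℂ (Set.range k) : Set E) := by
      rw [← Finsupp.range_linearCombination]; rfl
    rw [DenseRange, h]
    exact Submodule.dense_iff_topologicalClosure_eq_top.2 hk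
  let f : G → ((G →₀ ℂ) ≃ₗ[ℂ] (G →₀ ℂ)) := fun a => Finsupp.domLCongr (Equiv.mulLeft a)
  have he : ∀ a x, e (f a x) = x.sum fun g c => c • k (a * g) := by
    intro a x
    simp [e, f, Finsupp.linearCombination_apply, Finsupp.domLCongr_apply,
      Finsupp.equivMapDomain_eq_mapDomain, Finsupp.sum_mapDomain_index, add_smul]
  have hn : ∀ a x, ‖e (f a x)‖ = ‖e x‖ := by
    intro a x
    rw [norm_eq_sqrt_re_inner (𝕜 := ℂ), norm_eq_sqrt_re_inner (𝕜 := ℂ), he]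
    simp only [e, Finsupp.linearCombination_apply, Finsupp.sum, sum_inner, inner_sum,
      inner_smul_left, inner_smul_right, hinv]
  let T : G → (E ≃ₗᵢ[ℂ] E) := fun a => (f a).extendOfIsometry e e hd hd (hn a)
  have hT : ∀ a g, T a (k g) = k (a * g) := by
    intro a g
    have h := (f a).extendOfIsometry_eq e e hd hd (hn a) (Finsupp.single g 1)
    rw [he] at h
    simpa [T, e] using h
  have hext : ∀ A B : E ≃ₗᵢ[ℂ] E, (∀ g, A (k g) = B (k g)) → A = B := by
    intro A B h
    have : Set.EqOn A B (Submodule.span ℂ (Set.range k) : Set E) := by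
      intro x hx
      refine LinearMap.eqOn_span (f := A.toLinearEquiv.toLinearMap)
        (g := B.toLinearEquiv.toLinearMap) ?_ hx
      rintro _ ⟨g, rfl⟩
      exact h g
    ext x
    exact congrFun (Continuous.ext_on (Submodule.dense_iff_topologicalClosure_eq_top.2 hk)
      A.continuous B.continuous this) x
  refine ⟨MonoidHom.mk' T fun a b => hext _ _ fun g => ?_, hT⟩
  change T (a * b) (k g) = T a (T b (k g))
  rw [hT, hT, hT, mul_assoc]

/-- Every family of vectors is total in some Hilbert space, with the same Gram matrix. -/
theorem exists_total_family [CompleteSpace E] {ι : Type} (k : ι → E) :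
    ∃ (F : Type) (_ : NormedAddCommGroup F) (_ : InnerProductSpace ℂ F) (_ : CompleteSpace F)
      (k' : ι → F), (Submodule.span ℂ (Set.range k')).topologicalClosure = ⊤ ∧
        ∀ i j, inner ℂ (k' i) (k' j) = inner ℂ (k i) (k j) := by
  let W := (Submodule.span ℂ (Set.range k)).topologicalClosure
  have hW : IsClosed (W : Set E) := Submodule.isClosed_topologicalClosure _
  have hmem : ∀ i, k i ∈ W := fun i =>
    Submodule.le_topologicalClosure _ (Submodule.subset_span ⟨i, rfl⟩)
  let k' : ι → W := fun i => ⟨k i, hmem i⟩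
  refine ⟨W, inferInstance, inferInstance, hW.completeSpace_coe, k', ?_, fun i j => rfl⟩
  rw [← Submodule.dense_iff_topologicalClosure_eq_top]
  have himg : ((↑) : W → E) '' (Submodule.span ℂ (Set.range k') : Set W)
      = (Submodule.span ℂ (Set.range k) : Set E) := by
    have := Submodule.map_span W.subtype (Set.range k')
    rw [← Set.range_comp] at this
    exact congrArg (fun S : Submodule ℂ E => (S : Set E)) this
  intro x
  rw [Topology.IsInducing.subtypeVal.closure_eq_preimage_closure_image]
  change (x : E) ∈ closure (((↑) : W → E) '' (Submodule.span ℂ (Set.range k') : Set W))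
  rw [himg]
  exact x.2

/-- A fixed vector of a unitary representation vanishes as soon as the translates of a total
family along some sequence become asymptotically orthogonal to the family. -/
theorem eq_zero_of_fixed_of_tendsto {G : Type} [Group G] (k : G → E)
    (hk : (Submodule.span ℂ (Set.range k)).topologicalClosure = ⊤)
    (π : G →* (E ≃ₗᵢ[ℂ] E)) (hπ : ∀ a g, π a (k g) = k (a * g)) (u : ℕ → G)
    (hu : ∀ g h, Filter.Tendsto (fun n => inner ℂ (k (u n * g)) (k h)) Filter.atTop (nhds 0))
    (v : E) (hv : ∀ g, π g v = v) : v = 0 := by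
  have hdense := Submodule.dense_iff_topologicalClosure_eq_top.2 hk
  have hspan : ∀ w ∈ Submodule.span ℂ (Set.range k), ∀ g,
      Filter.Tendsto (fun n => inner ℂ (k (u n * g)) w) Filter.atTop (nhds 0) := by
    intro w hw g
    induction hw using Submodule.span_induction with
    | mem x hx => obtain ⟨h, rfl⟩ := hx; exact hu g h
    | zero => simp
    | add x y _ _ hx hy => simpa [inner_add_right] using hx.add hy
    | smul a x _ hx => simpa [inner_smul_right] using hx.const_mul a
  have horth : ∀ g, inner ℂ (k g) v = 0 := by
    intro g
    rw [← norm_le_zero_iff]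
    refine le_of_forall_pos_le_add fun δ hδ => ?_
    obtain ⟨w, hw, hvw⟩ : ∃ w ∈ (Submodule.span ℂ (Set.range k) : Set E),
        ‖k g‖ * ‖v - w‖ < δ := by
      obtain ⟨w, hw, hd⟩ := Metric.mem_closure_iff.1 (hdense v) (δ / (‖k g‖ + 1)) (by positivity)
      refine ⟨w, hw, ?_⟩
      rw [dist_eq_norm, lt_div_iff₀ (by positivity)] at hd
      nlinarith [norm_nonneg (v - w)]
    have hlim := ((hspan w hw g).norm).const_add δ
    rw [norm_zero, add_zero] at hlim
    rw [zero_add]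
    refine ge_of_tendsto' hlim fun n => ?_
    have h1 : inner ℂ (k g) v = inner ℂ (k (u n * g)) v := by
      rw [← hπ, ← LinearIsometryEquiv.inner_map_map (π (u n)) (k g) v, hv]
    have h2 : ‖k (u n * g)‖ = ‖k g‖ := by rw [← hπ, LinearIsometryEquiv.norm_map]
    have h3 : inner ℂ (k (u n * g)) v
        = inner ℂ (k (u n * g)) (v - w) + inner ℂ (k (u n * g)) w := by
      rw [← inner_add_right, sub_add_cancel]
    rw [h1, h3]
    refine (norm_add_le _ _).trans ?_
    gcongr
    exact (norm_inner_le_norm _ _).trans (h2 ▸ hvw.le)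
  refine hdense.eq_zero_of_inner_right (𝕜 := ℂ) fun w hw => ?_
  induction hw using Submodule.span_induction with
  | mem x hx => obtain ⟨h, rfl⟩ := hx; exact horth h
  | zero => simp
  | add x y _ _ hx hy => simp [inner_add_left, hx, hy]
  | smul a x _ hx => simp [inner_smul_left, hx]

end Kernel

/-- For `0 ≤ r ≤ 1` the kernel `(A, B) ↦ r ^ #(A ∆ B)` on finite sets is positive definite. -/
theorem exists_vectors_inner_eq_pow_card_symmDiff (X : Type) [DecidableEq X] (r : ℝ) (h0 : 0 ≤ r)
    (h1 : r ≤ 1) :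
    ∃ v : Finset X → lp (fun _ : Finset X => ℂ) 2,
      ∀ A B, inner ℂ (v A) (v B) = ((r ^ (A ∆ B).card : ℝ) : ℂ) := by
  have hs : Real.sqrt (1 - r ^ 2) ^ 2 = 1 - r ^ 2 := Real.sq_sqrt (by nlinarith)
  set s := Real.sqrt (1 - r ^ 2)
  let c : Finset X → Finset X → ℝ := fun A F => r ^ (A.card - F.card) * s ^ F.card
  refine ⟨fun A => ∑ F ∈ A.powerset, lp.single 2 F ((c A F : ℝ) : ℂ), fun A B => ?_⟩
  have hcoord : ∀ F G : Finset X, ∀ a b : ℝ,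
      inner ℂ (lp.single (E := fun _ : Finset X => ℂ) 2 F (a : ℂ))
        (lp.single (E := fun _ : Finset X => ℂ) 2 G (b : ℂ)) =
          if F = G then ((a * b : ℝ) : ℂ) else 0 := by
    intro F G a b
    rw [lp.inner_single_left, lp.single_apply]
    split_ifs with h
    · subst h; simp [mul_comm]
    · simp [Pi.single_eq_of_ne h]
  simp only [sum_inner, inner_sum, hcoord]
  have hinter : ∑ F ∈ A.powerset, ∑ G ∈ B.powerset,
      (if F = G then ((c A F * c B G : ℝ) : ℂ) else 0)
      = ∑ F ∈ (A ∩ B).powerset, ((c A F * c B F : ℝ) : ℂ) := by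
    have hp : (A ∩ B).powerset = A.powerset.filter (· ∈ B.powerset) := by
      ext F
      simp only [Finset.mem_filter, Finset.mem_powerset, Finset.subset_inter_iff]
    rw [hp, Finset.sum_filter]
    exact Finset.sum_congr rfl fun F _ => by rw [Finset.sum_ite_eq]
  have hA := Finset.card_sdiff_add_card_inter A B
  have hB := Finset.card_sdiff_add_card_inter B A
  rw [Finset.inter_comm B A] at hB
  have hcard : (A ∆ B).card = (A \ B).card + (B \ A).card :=
    Finset.card_union_of_disjoint disjoint_sdiff_sdiff
  have hterm : ∀ F ∈ (A ∩ B).powerset, c A F * c B F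
      = r ^ (A ∆ B).card * ((s ^ 2) ^ F.card * (r ^ 2) ^ ((A ∩ B).card - F.card)) := by
    intro F hF
    have hF := Finset.card_le_card (Finset.mem_powerset.1 hF)
    have e1 : A.card - F.card = (A \ B).card + ((A ∩ B).card - F.card) := by omega
    have e2 : B.card - F.card = (B \ A).card + ((A ∩ B).card - F.card) := by omega
    simp only [c, e1, e2, hcard]
    ring
  rw [Finset.sum_comm, hinter, ← Complex.ofReal_sum, Finset.sum_congr rfl hterm, ← Finset.mul_sum,
    Finset.sum_pow_mul_eq_add_pow, hs]
  simp

/-- A group acting on a set `X` and commensurating a subset `Z` with unbounded defect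
`#(Z ∆ g • Z)` does not have property (T). -/
theorem not_kazhdan_of_commensurated {G X : Type} [Group G] [MulAction G X] (Z : Set X)
    (hfin : ∀ g : G, (Z ∆ (g • Z)).Finite) (hunb : ∀ n : ℕ, ∃ g : G, n ≤ (Z ∆ (g • Z)).ncard)
    (S : Finset G) (ε : ℝ) (hε : 0 < ε) :
    ∃ (E : Type) (_ : NormedAddCommGroup E) (_ : InnerProductSpace ℂ E)
      (_ : CompleteSpace E) (π : G →* (E ≃ₗᵢ[ℂ] E)) (ξ : E),
      ‖ξ‖ = 1 ∧ (∀ s ∈ S, ‖π s ξ - ξ‖ < ε) ∧ ∀ v : E, (∀ g : G, π g v = v) → v = 0 := by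
  classical
  let D : G → Finset X := fun g => (hfin g).toFinset
  have hDcoe : ∀ g, (D g : Set X) = Z ∆ (g • Z) := fun g => (hfin g).coe_toFinset
  have hDsymm : ∀ g h, (D g ∆ D h).card = (D (g⁻¹ * h)).card := by
    intro g h
    rw [← Finset.card_smul_finset g (D (g⁻¹ * h))]
    congr 1
    rw [← Finset.coe_inj, Finset.coe_symmDiff, Finset.coe_smul_finset, hDcoe, hDcoe, hDcoe,
      Set.smul_set_symmDiff, smul_smul, mul_inv_cancel_left, symmDiff_symmDiff_symmDiff_comm,
      symmDiff_self, bot_symmDiff]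
  have hD1 : (D 1).card = 0 := by
    rw [Finset.card_eq_zero, ← Finset.coe_eq_empty, hDcoe, one_smul, symmDiff_self]; rfl
  have hDinv : ∀ g, (D g⁻¹).card = (D g).card := by
    intro g
    have h1 := hDsymm g 1
    have h2 := hDsymm 1 g
    rw [symmDiff_comm] at h2
    simpa using h1.symm.trans h2
  have hDmul : ∀ g h, (D (g * h)).card ≤ (D g).card + (D h).card := by
    intro g h
    rw [← hDinv g]
    have h1 := hDsymm g⁻¹ h
    rw [inv_inv] at h1
    rw [← h1]
    exact (Finset.card_union_le _ _).trans (by gcongr <;> exact Finset.sdiff_subset)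
  obtain ⟨r, hrS, hr0, hr1⟩ : ∃ r : ℝ,
      (∀ s ∈ S, 2 - 2 * r ^ (D s).card < ε ^ 2) ∧ 0 < r ∧ r < 1 := by
    have h1 : ∀ᶠ r : ℝ in nhdsWithin 1 (Set.Iio 1),
        ∀ s ∈ S, 2 - 2 * r ^ (D s).card < ε ^ 2 := by
      rw [Filter.eventually_all_finset]
      intro s _
      have hc : Continuous fun r : ℝ => 2 - 2 * r ^ (D s).card := by fun_prop
      have := (hc.tendsto 1).mono_left (nhdsWithin_le_nhds (s := Set.Iio 1))
      exact this.eventually_lt_const (by simp; positivity)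
    exact (h1.and (Ioo_mem_nhdsLT zero_lt_one)).exists
  obtain ⟨w, hw⟩ := exists_vectors_inner_eq_pow_card_symmDiff X r hr0.le hr1.le
  obtain ⟨E, _, _, _, k, hk, hkw⟩ := exists_total_family fun g => w (D g)
  have hinner : ∀ g h, inner ℂ (k g) (k h) = ((r ^ (D (g⁻¹ * h)).card : ℝ) : ℂ) := by
    intro g h
    rw [hkw, hw, hDsymm]
  obtain ⟨π, hπ⟩ := exists_unitaryRep_of_total k hk fun a g h => by
    rw [hinner, hinner, mul_inv_rev, mul_assoc, inv_mul_cancel_left]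
  have hnorm : ∀ g, ‖k g‖ = 1 := by
    intro g
    have h := inner_self_eq_norm_sq_to_K (𝕜 := ℂ) (k g)
    rw [hinner, inv_mul_cancel, hD1, pow_zero] at h
    have h' : (1 : ℝ) = ‖k g‖ ^ 2 := Complex.ofReal_injective (by simpa using h)
    exact (pow_eq_one_iff_of_nonneg (norm_nonneg _) two_ne_zero).1 h'.symm
  choose u hu using hunb
  refine ⟨E, inferInstance, inferInstance, inferInstance, π, k 1, hnorm 1, fun s hs => ?_,
    eq_zero_of_fixed_of_tendsto k hk π hπ u fun g h => ?_⟩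
  · rw [hπ, mul_one]
    refine lt_of_pow_lt_pow_left₀ 2 hε.le ?_
    rw [@norm_sub_sq ℂ, hnorm, hnorm, hinner, mul_one, hDinv]
    simp only [RCLike.re_to_complex, Complex.ofReal_re]
    linarith [hrS s hs]
  · simp only [hinner]
    rw [← Complex.ofReal_zero]
    refine (Complex.continuous_ofReal.tendsto 0).comp ?_
    refine (tendsto_pow_atTop_nhds_zero_of_lt_one hr0.le hr1).comp ?_
    refine Filter.tendsto_atTop_mono (f := fun n => n - ((D g).card + (D h).card)) (fun n => ?_)
      (Filter.tendsto_sub_atTop_nat _)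
    have h1 : n ≤ (D (u n)).card := by
      have := hu n
      rwa [← hDcoe, Set.ncard_coe_finset] at this
    have h2 := hDmul (g * ((u n * g)⁻¹ * h)) h⁻¹
    have h3 := hDmul g ((u n * g)⁻¹ * h)
    have h4 : g * ((u n * g)⁻¹ * h) * h⁻¹ = (u n)⁻¹ := by group
    rw [h4, hDinv, hDinv] at h2
    omega

/-- The increasing affine maps of `[0,1)` onto the half-open standard dyadic intervals. -/
def dyadicEmbeddings : Set (Set.Ico (0:ℝ) 1 → Set.Ico (0:ℝ) 1) :=
  {f | ∃ k m : ℕ, ∀ t, (f t : ℝ) = (k + t) / 2 ^ m}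

/-- Any point between the end points of a finite sequence of reals lies in one of its steps. -/
theorem exists_mem_Ico_castSucc_succ {n : ℕ} (x : Fin (n + 1) → ℝ) {t : ℝ} (h0 : x 0 ≤ t)
    (h1 : t < x (Fin.last n)) : ∃ i : Fin n, t ∈ Set.Ico (x i.castSucc) (x i.succ) := by
  by_contra! h
  have : ∀ i, x i ≤ t := by
    intro i
    induction i using Fin.induction with
    | zero => exact h0
    | succ i ih => exact not_lt.1 fun hlt => h i ⟨ih, hlt⟩
  exact absurd (this _) (not_le.2 h1)

/-- If `k / 2 ^ m` lies to the left of a dyadic rational `j / 2 ^ p` of level `p ≤ m`, then so does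
the whole half-open interval `[k / 2 ^ m, (k + 1) / 2 ^ m)`. -/
theorem add_div_two_pow_lt {j k p m : ℕ} {t : ℝ} (hp : p ≤ m) (ht : t < 1)
    (h : (k : ℝ) / 2 ^ m < (j : ℝ) / 2 ^ p) : ((k : ℝ) + t) / 2 ^ m < (j : ℝ) / 2 ^ p := by
  obtain ⟨d, rfl⟩ := Nat.exists_eq_add_of_le hp
  have hj : (j : ℝ) / 2 ^ p = ((j * 2 ^ d : ℕ) : ℝ) / 2 ^ (p + d) := by
    push_cast
    rw [pow_add]
    field_simp
  rw [hj, div_lt_div_iff_of_pos_right (by positivity)] at h ⊢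
  have h' : k + 1 ≤ j * 2 ^ d := by exact_mod_cast h
  have h'' : (k : ℝ) + 1 ≤ ((j * 2 ^ d : ℕ) : ℝ) := by exact_mod_cast h'
  linarith

/-- An element of `V` maps all but finitely many standard dyadic intervals affinely onto
standard dyadic intervals. -/
theorem IsThompsonV.finite_setOf_comp_notMem {g : Equiv.Perm (Set.Ico (0:ℝ) 1)}
    (hg : IsThompsonV g) : {f ∈ dyadicEmbeddings | ⇑g ∘ f ∉ dyadicEmbeddings}.Finite := by
  obtain ⟨n, x, y, σ, ⟨hx0, hx1, -, hx⟩, ⟨-, -, -, hy⟩, hg⟩ := hg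
  choose k m hk hk' _ using hx
  choose l q hl hl' _ using hy
  let M := Finset.univ.sup m
  let T : Set (ℕ × ℕ) := (Finset.range (2 ^ M) ×ˢ Finset.range M : Finset (ℕ × ℕ))
  let P : (Set.Ico (0:ℝ) 1 → Set.Ico (0:ℝ) 1) → ℕ × ℕ → Prop :=
    fun f a => ∀ t, (f t : ℝ) = (a.1 + t) / 2 ^ a.2
  have hT : (⋃ a ∈ T, {f | P f a}).Finite := by
    refine (Finset.finite_toSet _).biUnion fun a _ => Set.Subsingleton.finite ?_
    intro f hf f' hf'
    funext t
    exact Subtype.ext ((hf t).trans (hf' t).symm)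
  refine hT.subset ?_
  rintro f ⟨⟨c, r, hf⟩, hgf⟩
  have hz : (0:ℝ) ∈ Set.Ico (0:ℝ) 1 := by simp
  have hc : (c : ℝ) / 2 ^ r < 1 := by
    have h1 := (f ⟨0, hz⟩).2.2
    rw [hf] at h1
    simpa using h1
  have hr : r < M := by
    by_contra! hMr
    refine hgf ?_
    obtain ⟨i, hi1, hi2⟩ := exists_mem_Ico_castSucc_succ x (t := (c : ℝ) / 2 ^ r)
      (by rw [hx0]; positivity) (by rw [hx1]; exact hc)
    have hmr : m i ≤ r := (Finset.le_sup (Finset.mem_univ i)).trans hMr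
    have hkr : k i * 2 ^ (r - m i) ≤ c := by
      rw [hk, div_le_div_iff₀ (by positivity) (by positivity)] at hi1
      have : k i * 2 ^ r ≤ c * 2 ^ m i := by exact_mod_cast hi1
      rw [← Nat.sub_add_cancel hmr, pow_add, ← mul_assoc] at this
      exact Nat.le_of_mul_le_mul_right this (by positivity)
    refine ⟨l (σ i) * 2 ^ (r - m i) + (c - k i * 2 ^ (r - m i)), q (σ i) + (r - m i), fun t => ?_⟩
    have hft : (f t : ℝ) ∈ Set.Ico (x i.castSucc) (x i.succ) := by
      rw [hf]
      constructor
      · refine hi1.trans ?_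
        gcongr
        linarith [t.2.1]
      · rw [hk'] at hi2 ⊢
        exact_mod_cast add_div_two_pow_lt (j := k i + 1) hmr t.2.2 (by exact_mod_cast hi2)
    have h2 := hg i _ hft
    rw [extIco, dif_pos (f t).2] at h2
    change (g (f t) : ℝ) = _
    refine h2.trans ?_
    rw [hf, hl, hl', hk, hk']
    push_cast [Nat.cast_sub hkr]
    obtain ⟨d, rfl⟩ := Nat.exists_eq_add_of_le hmr
    rw [Nat.add_sub_cancel_left, pow_add, pow_add]
    field_simp
    ring
  have hcM : c < 2 ^ M := by
    rw [div_lt_one (by positivity)] at hc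
    have : c < 2 ^ r := by exact_mod_cast hc
    exact this.trans (Nat.pow_lt_pow_right one_lt_two hr)
  simp only [Set.mem_iUnion]
  exact ⟨(c, r), by simp [T, hcM, hr], hf⟩

/-- The exchange of `[0, a)` and `[a, 2a)`, for `a = 1 / 2 ^ (n + 1)`. -/
theorem exists_isThompsonV_exchange (n : ℕ) :
    ∃ g : Equiv.Perm (Set.Ico (0:ℝ) 1), IsThompsonV g ∧ g⁻¹ = g ∧
      (∀ t : Set.Ico (0:ℝ) 1, (t : ℝ) = 0 → (g t : ℝ) = 1 / 2 ^ (n + 1)) ∧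
      (∀ t : Set.Ico (0:ℝ) 1, (t : ℝ) = 1 / 2 ^ (n + 1) → (g t : ℝ) = 0) := by
  have ha0 : (0:ℝ) < 1 / 2 ^ (n + 1) := by positivity
  have ha1 : (1:ℝ) / 2 ^ (n + 1) ≤ 1 / 2 := by
    rw [pow_succ]
    gcongr
    exact le_mul_of_one_le_left zero_le_two (one_le_pow₀ one_le_two)
  obtain ⟨a, ha⟩ : ∃ a : ℝ, a = 1 / 2 ^ (n + 1) := ⟨_, rfl⟩
  rw [← ha] at ha0 ha1 ⊢
  let φ : ℝ → ℝ := fun t => if t < a then t + a else if t < 2 * a then t - a else t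
  have hφ : ∀ t ∈ Set.Ico (0:ℝ) 1, φ t ∈ Set.Ico (0:ℝ) 1 := by
    rintro t ⟨h0, h1⟩
    simp only [φ]
    split_ifs <;> constructor <;> linarith
  have hφφ : ∀ t ∈ Set.Ico (0:ℝ) 1, φ (φ t) = t := by
    rintro t ⟨h0, h1⟩
    simp only [φ]
    split_ifs <;> linarith
  let ψ : Set.Ico (0:ℝ) 1 → Set.Ico (0:ℝ) 1 := fun t => ⟨φ t, hφ t t.2⟩
  have hψ : Function.Involutive ψ := fun t => Subtype.ext (hφφ t t.2)
  refine ⟨hψ.toPerm, ?_, hψ.toPerm_symm, fun t ht => ?_, fun t ht => ?_⟩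
  · have hN : 1 < 2 ^ (n + 1) := Nat.one_lt_two_pow (Nat.succ_ne_zero n)
    have hpart : IsStdDyadicPartition fun i : Fin (2 ^ (n + 1) + 1) => (i : ℝ) / 2 ^ (n + 1) := by
      refine ⟨by simp, by simp, fun i j hij => ?_, fun i => ⟨i, n + 1, by simp, by simp, ?_⟩⟩
      · have : (i : ℕ) < j := hij
        dsimp only
        gcongr
      · rw [div_le_one (by positivity)]
        exact_mod_cast i.succ.is_le
    refine ⟨2 ^ (n + 1), _, _, Equiv.swap ⟨0, by omega⟩ ⟨1, hN⟩, hpart, hpart, ?_⟩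
    intro i t ht
    have hdiv : ∀ z : ℝ, z / 2 ^ (n + 1) = z * a := fun z => by rw [ha]; ring
    have hslope : ∀ z : ℝ, (z + 1) * a - z * a = a := fun z => by ring
    have ht1 : t ∈ Set.Ico (0:ℝ) 1 :=
      ⟨le_trans (by positivity) ht.1, ht.2.trans_le (by
        obtain ⟨_, _, _, _, h⟩ := hpart.2.2.2 i
        exact h)⟩
    rw [extIco, dif_pos ht1]
    change φ t = _
    simp only [Fin.val_castSucc, Fin.val_succ, Nat.cast_add, Nat.cast_one, hdiv, hslope,
      div_self ha0.ne', one_mul] at ht ⊢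
    by_cases hi0 : i = ⟨0, by omega⟩
    · subst hi0
      simp only [Nat.cast_zero, zero_mul, zero_add, one_mul] at ht
      simp [φ, ht.2]
      ring
    by_cases hi1 : i = ⟨1, hN⟩
    · subst hi1
      simp only [Nat.cast_one, one_mul] at ht
      have : t < 2 * a := by linarith [ht.2]
      simp [φ, this, not_lt.2 ht.1]
    · rw [Equiv.swap_apply_of_ne_of_ne hi0 hi1]
      have hi2 : 2 ≤ (i : ℕ) := by
        have h0 : (i : ℕ) ≠ 0 := fun h => hi0 (Fin.ext h)
        have h1 : (i : ℕ) ≠ 1 := fun h => hi1 (Fin.ext h)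
        omega
      have hi3 : (2 : ℝ) * a ≤ i * a := by
        gcongr
        exact_mod_cast hi2
      have h4 : ¬ t < 2 * a := by linarith [ht.1]
      have h5 : ¬ t < a := by linarith
      simp [φ, h4, h5]
  · change φ t = a
    simp [φ, ht, ha0]
  · change φ t = 0
    have h2 : a < 2 * a := by linarith
    simp [φ, ht, h2]

/-- Thompson's group `V` (realized as the subgroup `H` of the group of bijections of
`[0,1)`) does not have Kazhdan's property (T): for every finite `S ⊆ V` and `ε > 0`
there are a complex Hilbert space, a unitary representation `π` of `V` on it and a unit
vector `ξ` with `‖π(s)ξ − ξ‖ < ε` for all `s ∈ S`, while the only `π(V)`-fixed vector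
is `0`. -/
theorem thompsonV_not_kazhdan
    (H : Subgroup (Equiv.Perm (Set.Ico (0:ℝ) 1)))
    (hH : ∀ g, g ∈ H ↔ IsThompsonV g) :
    ∀ (S : Finset H) (ε : ℝ), 0 < ε →
      ∃ (E : Type) (_ : NormedAddCommGroup E) (_ : InnerProductSpace ℂ E)
        (_ : CompleteSpace E) (π : H →* (E ≃ₗᵢ[ℂ] E)) (ξ : E),
        ‖ξ‖ = 1 ∧ (∀ s ∈ S, ‖π s ξ - ξ‖ < ε) ∧
        ∀ v : E, (∀ g : H, π g v = v) → v = 0 := by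
  have hfin : ∀ g : H, (dyadicEmbeddings ∆ (g • dyadicEmbeddings)).Finite := by
    intro g
    refine Set.Finite.union ?_ ?_
    · refine ((hH _).1 (g⁻¹).2).finite_setOf_comp_notMem.subset ?_
      rintro f ⟨hf, hgf⟩
      exact ⟨hf, fun h => hgf (Set.mem_smul_set_iff_inv_smul_mem.2 h)⟩
    · refine (((hH _).1 g.2).finite_setOf_comp_notMem.smul_set (a := g)).subset ?_
      rintro _ ⟨⟨f, hf, rfl⟩, hgf⟩
      exact ⟨f, ⟨hf, hgf⟩, rfl⟩
  refine not_kazhdan_of_commensurated dyadicEmbeddings hfin fun n => ?_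
  obtain ⟨g, hgV, hinv, hg0, hg1⟩ := exists_isThompsonV_exchange n
  let gH : H := ⟨g, (hH g).2 hgV⟩
  have hmem : ∀ (m : ℕ) (t : Set.Ico (0:ℝ) 1), (t : ℝ) / 2 ^ m ∈ Set.Ico (0:ℝ) 1 := fun m t =>
    ⟨div_nonneg t.2.1 (by positivity),
      (div_le_self t.2.1 (one_le_pow₀ one_le_two)).trans_lt t.2.2⟩
  let f : ℕ → Set.Ico (0:ℝ) 1 → Set.Ico (0:ℝ) 1 := fun m t => ⟨t / 2 ^ m, hmem m t⟩
  have hhalf : (1 / 2 : ℝ) ∈ Set.Ico (0:ℝ) 1 := by norm_num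
  have hz : (0:ℝ) ∈ Set.Ico (0:ℝ) 1 := by simp
  have hinj : Function.Injective f := by
    intro m m' h
    have h1 : (1 / 2 : ℝ) / 2 ^ m = 1 / 2 / 2 ^ m' :=
      congrArg Subtype.val (congrFun h ⟨1 / 2, hhalf⟩)
    rw [div_eq_mul_inv, div_eq_mul_inv _ ((2:ℝ) ^ m'), mul_right_inj' (by norm_num), inv_inj] at h1
    exact pow_right_injective₀ (by norm_num) (by norm_num) h1
  have hsub : f '' (Finset.range n : Set ℕ) ⊆ dyadicEmbeddings ∆ (gH • dyadicEmbeddings) := by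
    rintro _ ⟨m, hm, rfl⟩
    have hm : m < n := by simpa using hm
    refine Or.inl ⟨⟨0, m, fun t => by simp [f]⟩, fun h => ?_⟩
    rw [Set.mem_smul_set_iff_inv_smul_mem] at h
    obtain ⟨c, r, h⟩ := h
    have h : ∀ t, (g (f m t) : ℝ) = (c + t) / 2 ^ r := by
      intro t
      rw [← h t, ← hinv]
      rfl
    have hb : (2:ℝ) ^ m / 2 ^ (n + 1) ∈ Set.Ico (0:ℝ) 1 := by
      refine ⟨by positivity, ?_⟩
      rw [div_lt_one (by positivity)]
      exact pow_lt_pow_right₀ one_lt_two (by omega)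
    have h0 := h ⟨0, hz⟩
    have h1 := h ⟨_, hb⟩
    rw [hg0 _ (by simp [f])] at h0
    rw [hg1 _ (by simp only [f]; field_simp)] at h1
    have h2 : (c + 0 : ℝ) / 2 ^ r ≤ (c + 2 ^ m / 2 ^ (n + 1)) / 2 ^ r := by
      gcongr
      exact hb.1
    have h3 : (0:ℝ) < 1 / 2 ^ (n + 1) := by positivity
    simp only at h0 h1
    linarith
  refine ⟨gH, le_trans ?_ (Set.ncard_le_ncard hsub (hfin gH))⟩
  rw [Set.ncard_image_of_injective _ hinj, Set.ncard_coe_finset, Finset.card_range]
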